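/- Five-term complementarity relation used in the odd-cycle argument: Let h ≥ 5, consider 2h qubits labeled 1,…,2h, and let α, β, γ, δ be real numbers with α² + β² = 1 and γ² + δ² = 1. Define M₆ = α σ_x^{(5)} σ_x^{(6)} σ_y^{(7)} + β σ_x^{(5)} σ_y^{(6)} σ_y^{(7)} and M_{2h} = γ σ_x^{(2h−1)} σ_x^{(2h)} σ_y^{(1)} + δ σ_x^{(2h−1)} σ_y^{(2h)} σ_y^{(1)}. Then for every 2h-qubit density matrix ρ, (Tr(ρ σ_x^{(1)} σ_x^{(2)} σ_y^{(3)}))² + (Tr(ρ σ_x^{(1)} σ_y^{(2)} σ_y^{(3)}))² + (Tr(ρ σ_x^{(3)} σ_x^{(4)} σ_y^{(5)}))² + (Tr(ρ σ_x^{(3)} σ_y^{(4)} σ_y^{(5)}))² + (Tr(ρ M₆ M_{2h}))² ≤ 1. -/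

import Mathlib

open Matrix Complex ComplexOrder

noncomputable section

/-- The Pauli X matrix. -/
def pX : Matrix (Fin 2) (Fin 2) ℂ := !![0, 1; 1, 0]

/-- The Pauli Y matrix. -/
def pY : Matrix (Fin 2) (Fin 2) ℂ := !![0, -Complex.I; Complex.I, 0]

/-- The Pauli Z matrix. -/
def pZ : Matrix (Fin 2) (Fin 2) ℂ := !![1, 0; 0, -1]

/-- The operator on `n` qubits acting as the single-qubit operator `M` on qubit `i`
and as the identity on all other qubits. -/
def onQubit {n : ℕ} (M : Matrix (Fin 2) (Fin 2) ℂ) (i : Fin n) :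
    Matrix (Fin n → Fin 2) (Fin n → Fin 2) ℂ :=
  Matrix.of fun a b => ∏ s, if s = i then M (a s) (b s) else (if a s = b s then 1 else 0)

/-- An `n`-qubit density matrix: positive semidefinite with unit trace. -/
def IsDensityMatrix {n : ℕ} (ρ : Matrix (Fin n → Fin 2) (Fin n → Fin 2) ℂ) : Prop :=
  ρ.PosSemidef ∧ ρ.trace = 1

/-- The two Pauli matrices spanning the xy plane. -/
def XY : Fin 2 → Matrix (Fin 2) (Fin 2) ℂ := ![pX, pY]

/-- The two Pauli matrices spanning the xz plane. -/
def XZ : Fin 2 → Matrix (Fin 2) (Fin 2) ℂ := ![pX, pZ]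

/-- The xy-plane Bell strength 𝒯²_{ij}(ρ) of the pair of qubits (i,j). -/
def T2pair {n : ℕ} (ρ : Matrix (Fin n → Fin 2) (Fin n → Fin 2) ℂ) (i j : Fin n) : ℝ :=
  ∑ k : Fin 2, ∑ l : Fin 2,
    ((ρ * (onQubit (XY k) i * onQubit (XY l) j)).trace.re) ^ 2

/-- The xy-plane Bell strength 𝒯²_{ijm}(ρ) of the triple of qubits (i,j,m). -/
def T2triple {n : ℕ} (ρ : Matrix (Fin n → Fin 2) (Fin n → Fin 2) ℂ) (i j m : Fin n) : ℝ :=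
  ∑ k : Fin 2, ∑ l : Fin 2, ∑ p : Fin 2,
    ((ρ * (onQubit (XY k) i * onQubit (XY l) j * onQubit (XY p) m)).trace.re) ^ 2

/-- The xy-plane Bell strength 𝒯²_{ijml}(ρ) of the quadruple of qubits (i,j,m,l). -/
def T2quad {n : ℕ} (ρ : Matrix (Fin n → Fin 2) (Fin n → Fin 2) ℂ) (i j m l : Fin n) : ℝ :=
  ∑ k : Fin 2, ∑ k' : Fin 2, ∑ k'' : Fin 2, ∑ k''' : Fin 2,
    ((ρ * (onQubit (XY k) i * onQubit (XY k') j * onQubit (XY k'') m *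
        onQubit (XY k''') l)).trace.re) ^ 2

/-- The xz-plane Bell strength of the pair of qubits (i,j). -/
def T2pairXZ {n : ℕ} (ρ : Matrix (Fin n → Fin 2) (Fin n → Fin 2) ℂ) (i j : Fin n) : ℝ :=
  ∑ k : Fin 2, ∑ l : Fin 2,
    ((ρ * (onQubit (XZ k) i * onQubit (XZ l) j)).trace.re) ^ 2

/-- `a` and `b` commute up to the scalar `e`. -/
def CommuteUpTo {R : Type*} [Ring R] (e : ℤ) (a b : R) : Prop :=
  a * b = e • (b * a)

namespace CommuteUpTo

variable {R : Type*} [Ring R] {e f : ℤ} {a b c : R}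

theorem mul_right (hab : CommuteUpTo e a b) (hac : CommuteUpTo f a c) :
    CommuteUpTo (e * f) a (b * c) := by
  unfold CommuteUpTo at *
  rw [← mul_assoc, hab, smul_mul_assoc, mul_assoc, hac, mul_smul_comm, smul_smul, mul_assoc]

theorem mul_left (hac : CommuteUpTo e a c) (hbc : CommuteUpTo f b c) :
    CommuteUpTo (e * f) (a * b) c := by
  unfold CommuteUpTo at *
  rw [mul_assoc, hbc, mul_smul_comm, ← mul_assoc, hac, smul_mul_assoc, smul_smul, mul_assoc,
    mul_comm f]

theorem symm_of_mul_self (he : e * e = 1) (hab : CommuteUpTo e a b) : CommuteUpTo e b a := by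
  unfold CommuteUpTo at *
  rw [hab, smul_smul, he, one_smul]

theorem smul_add_smul_right [Algebra ℂ R] (hab : CommuteUpTo e a b) (hac : CommuteUpTo e a c)
    (x y : ℂ) : CommuteUpTo e a (x • b + y • c) := by
  unfold CommuteUpTo at *
  simp only [mul_add, add_mul, mul_smul_comm, smul_mul_assoc, hab, hac, smul_add]
  rw [smul_comm x, smul_comm y]

end CommuteUpTo

theorem mul_self_mul_eq_one {R : Type*} [Ring R] {a b : R} (ha : a * a = 1) (hb : b * b = 1)
    (hab : CommuteUpTo 1 a b) : a * b * (a * b) = 1 := by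
  have h : a * b = b * a := by simpa [CommuteUpTo] using hab
  nth_rewrite 2 [h]
  rw [mul_assoc, ← mul_assoc b, hb, one_mul, ha]

theorem mul_self_smul_add_smul_eq_one {R : Type*} [Ring R] [Algebra ℂ R] {a b : R}
    (ha : a * a = 1) (hb : b * b = 1) (hab : CommuteUpTo (-1) a b) {x y : ℝ}
    (hxy : x ^ 2 + y ^ 2 = 1) :
    ((x : ℂ) • a + (y : ℂ) • b) * ((x : ℂ) • a + (y : ℂ) • b) = 1 := by
  have h : a * b = -(b * a) := by simpa [CommuteUpTo] using hab
  have hc : (x : ℂ) * x + y * y = 1 := by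
    have := congrArg (fun t : ℝ => (t : ℂ)) hxy
    push_cast at this
    linear_combination this
  simp only [mul_add, add_mul, mul_smul_comm, smul_mul_assoc, ha, hb, h, smul_neg]
  rw [smul_add, smul_add, smul_neg, smul_comm (y : ℂ) (x : ℂ)]
  calc _ = ((x : ℂ) * x + y * y) • (1 : R) := by rw [add_smul, mul_smul, mul_smul]; abel
    _ = 1 := by rw [hc, one_smul]

theorem Matrix.IsHermitian.mul_of_commuteUpTo_one {ι : Type*} [Fintype ι] [DecidableEq ι]
    {A B : Matrix ι ι ℂ} (hA : A.IsHermitian) (hB : B.IsHermitian) (h : CommuteUpTo 1 A B) :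
    (A * B).IsHermitian := by
  rw [Matrix.IsHermitian, conjTranspose_mul, hA.eq, hB.eq]
  simpa [CommuteUpTo] using h.symm

theorem Matrix.IsHermitian.ofReal_smul {ι : Type*} {A : Matrix ι ι ℂ} (hA : A.IsHermitian)
    (x : ℝ) : ((x : ℂ) • A).IsHermitian := by
  rw [Matrix.IsHermitian, conjTranspose_smul, hA.eq]
  simp

/-- Squared expectation values of pairwise anticommuting Hermitian involutions sum to at most
one in every state. -/
theorem sum_sq_trace_re_le_one {ι κ : Type*} [Fintype ι] [DecidableEq ι] [Fintype κ]
    [DecidableEq κ] {ρ : Matrix ι ι ℂ} (hρ : ρ.PosSemidef) (htr : ρ.trace = 1)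
    (A : κ → Matrix ι ι ℂ) (hA : ∀ i, (A i).IsHermitian) (hsq : ∀ i, A i * A i = 1)
    (hanti : ∀ i j, i ≠ j → CommuteUpTo (-1) (A i) (A j)) :
    ∑ i, ((ρ * A i).trace.re) ^ 2 ≤ 1 := by
  set c : κ → ℝ := fun i => (ρ * A i).trace.re with hc
  set s : ℝ := ∑ i, c i ^ 2 with hs
  set B : Matrix ι ι ℂ := ∑ i, (c i : ℂ) • A i with hB
  have hBH : B.IsHermitian := by
    rw [Matrix.IsHermitian, hB, conjTranspose_sum]
    exact Finset.sum_congr rfl fun i _ => ((hA i).ofReal_smul (c i)).eq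
  have hBB : B * B = (s : ℂ) • 1 := by
    have h1 : B * B = ∑ i, ∑ j, ((c i : ℂ) * c j) • (A i * A j) := by
      simp only [hB, Finset.sum_mul_sum, smul_mul_smul_comm]
    have h2 : B * B = ∑ i, ∑ j, ((c i : ℂ) * c j) • (A j * A i) := by
      rw [h1, Finset.sum_comm]
      exact Finset.sum_congr rfl fun i _ => Finset.sum_congr rfl fun j _ => by
        rw [mul_comm (c i : ℂ)]
    have h3 : (2 : ℂ) • (B * B) = (2 : ℂ) • ((s : ℂ) • (1 : Matrix ι ι ℂ)) := by
      rw [two_smul]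
      nth_rewrite 1 [h1]
      rw [h2, ← Finset.sum_add_distrib]
      have h4 : ∀ i, (∑ j, ((c i : ℂ) * c j) • (A i * A j) + ∑ j, ((c i : ℂ) * c j) • (A j * A i))
          = (2 * (c i : ℂ) ^ 2) • (1 : Matrix ι ι ℂ) := by
        intro i
        rw [← Finset.sum_add_distrib, Finset.sum_eq_single i]
        · rw [hsq, ← add_smul]
          congr 1
          ring
        · intro j _ hj
          have := hanti i j hj.symm
          simp only [CommuteUpTo, neg_smul, one_smul] at this
          rw [this, smul_neg, neg_add_cancel]
        · simp
      rw [Finset.sum_congr rfl fun i _ => h4 i, ← Finset.sum_smul, smul_smul, hs]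
      push_cast
      rw [Finset.mul_sum]
    exact smul_right_injective _ (two_ne_zero (α := ℂ)) h3
  have hpos : 0 ≤ (ρ * ((B - 1) * (B - 1))).trace := by
    have h := (hρ.mul_mul_conjTranspose_same (B - 1)).trace_nonneg
    rw [(hBH.sub isHermitian_one).eq, mul_assoc, trace_mul_comm, mul_assoc] at h
    exact h
  have hre : (ρ * B).trace.re = s := by
    simp only [hB, Finset.mul_sum, mul_smul_comm, trace_sum, trace_smul, Complex.re_sum,
      smul_eq_mul, Complex.re_ofReal_mul, hs]
    exact Finset.sum_congr rfl fun i _ => (sq (c i)).symm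
  have hexp : (B - 1) * (B - 1) = ((s : ℂ) • 1 - B) - (B - 1) := by
    rw [← hBB]
    noncomm_ring
  have hval : (ρ * ((B - 1) * (B - 1))).trace.re = s - s - (s - 1) := by
    rw [hexp]
    simp only [mul_sub, trace_sub, mul_smul_comm, mul_one, trace_smul, htr, Complex.sub_re, hre]
    simp
  have := (Complex.nonneg_iff.mp hpos).1
  linarith

/-- The tensor product of single-qubit operators. -/
def tensorOp {n : ℕ} (M : Fin n → Matrix (Fin 2) (Fin 2) ℂ) :
    Matrix (Fin n → Fin 2) (Fin n → Fin 2) ℂ :=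
  Matrix.of fun a b => ∏ s, M s (a s) (b s)

theorem tensorOp_mul {n : ℕ} (M N : Fin n → Matrix (Fin 2) (Fin 2) ℂ) :
    tensorOp M * tensorOp N = tensorOp (M * N) := by
  ext a b
  simp only [tensorOp, Matrix.mul_apply, Matrix.of_apply, Pi.mul_apply, ← Finset.prod_mul_distrib]
  rw [Finset.prod_univ_sum]
  simp

theorem onQubit_eq_tensorOp {n : ℕ} (M : Matrix (Fin 2) (Fin 2) ℂ) (i : Fin n) :
    onQubit M i = tensorOp (Pi.mulSingle i M) := by
  ext a b
  simp only [onQubit, tensorOp, Matrix.of_apply]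
  refine Finset.prod_congr rfl fun s _ => ?_
  by_cases hs : s = i
  · subst hs
    simp
  · simp [hs, Matrix.one_apply]

theorem onQubit_mul_onQubit {n : ℕ} (M N : Matrix (Fin 2) (Fin 2) ℂ) (i : Fin n) :
    onQubit M i * onQubit N i = onQubit (M * N) i := by
  simp only [onQubit_eq_tensorOp, tensorOp_mul, Pi.mulSingle_mul]

theorem onQubit_mul_comm {n : ℕ} (M N : Matrix (Fin 2) (Fin 2) ℂ) {i j : Fin n} (hij : i ≠ j) :
    onQubit M i * onQubit N j = onQubit N j * onQubit M i := by
  simp only [onQubit_eq_tensorOp, tensorOp_mul]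
  exact congrArg tensorOp
    (Pi.mulSingle_commute (f := fun _ => Matrix (Fin 2) (Fin 2) ℂ) hij M N).eq

theorem onQubit_one {n : ℕ} (i : Fin n) : onQubit 1 i = 1 := by
  ext a b
  simp only [onQubit_eq_tensorOp, Pi.mulSingle_one, tensorOp, Matrix.of_apply, Pi.one_apply,
    Matrix.one_apply, Finset.prod_ite_zero]
  simp [funext_iff]

theorem onQubit_neg {n : ℕ} (M : Matrix (Fin 2) (Fin 2) ℂ) (i : Fin n) :
    onQubit (-M) i = -onQubit M i := by
  ext a b
  simp only [onQubit, Matrix.of_apply, Matrix.neg_apply]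
  rw [← Finset.mul_prod_erase _ _ (Finset.mem_univ i),
    ← Finset.mul_prod_erase _ _ (Finset.mem_univ i)]
  simp only [if_true, neg_mul, neg_inj]
  congr 1
  refine Finset.prod_congr rfl fun s hs => ?_
  simp [Finset.ne_of_mem_erase hs]

theorem onQubit_isHermitian {n : ℕ} {M : Matrix (Fin 2) (Fin 2) ℂ} (hM : M.IsHermitian)
    (i : Fin n) : (onQubit M i).IsHermitian := by
  ext a b
  simp only [onQubit, Matrix.conjTranspose_apply, Matrix.of_apply, star_prod]
  refine Finset.prod_congr rfl fun s _ => ?_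
  split_ifs with h1 h2 h3 h3
  · exact hM.apply _ _
  · simp
  · exact absurd h2.symm h3
  · exact absurd h3.symm h2
  · simp

theorem XY_isHermitian (k : Fin 2) : (XY k).IsHermitian := by
  fin_cases k <;> ext i j <;> fin_cases i <;> fin_cases j <;> simp [XY, pX, pY]

theorem XY_mul_self (k : Fin 2) : XY k * XY k = 1 := by
  fin_cases k <;> ext i j <;> fin_cases i <;> fin_cases j <;> simp [XY, pX, pY]

theorem XY_mul_of_ne {k l : Fin 2} (hkl : k ≠ l) : XY k * XY l = -(XY l * XY k) := by
  fin_cases k <;> fin_cases l <;> first | exact absurd rfl hkl | skip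
  all_goals ext i j; fin_cases i <;> fin_cases j <;> simp [XY, pX, pY]

/-- The sign picked up when exchanging the Pauli matrices `XY k` on qubit `i` and `XY l` on
qubit `j`. -/
def pauliSign {n : ℕ} (k l : Fin 2) (i j : Fin n) : ℤ :=
  if i = j ∧ k ≠ l then -1 else 1

theorem commuteUpTo_onQubit_XY {n : ℕ} (k l : Fin 2) (i j : Fin n) :
    CommuteUpTo (pauliSign k l i j) (onQubit (XY k) i) (onQubit (XY l) j) := by
  unfold CommuteUpTo pauliSign
  split_ifs with h
  · obtain ⟨rfl, hkl⟩ := h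
    rw [onQubit_mul_onQubit, XY_mul_of_ne hkl, onQubit_neg, onQubit_mul_onQubit, neg_smul,
      one_smul]
  · rw [one_smul]
    by_cases hij : i = j
    · have hkl : k = l := by
        by_contra hkl
        exact h ⟨hij, hkl⟩
      rw [hij, hkl]
    · exact onQubit_mul_comm _ _ hij

/-- The operator acting as `σ_x` on qubit `i`, as `XY k` on qubit `j` and as `σ_y` on
qubit `m`. -/
def tripleOp {n : ℕ} (k : Fin 2) (i j m : Fin n) : Matrix (Fin n → Fin 2) (Fin n → Fin 2) ℂ :=
  onQubit (XY 0) i * onQubit (XY k) j * onQubit (XY 1) m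

theorem commuteUpTo_tripleOp {n : ℕ} {e : ℤ} (k l : Fin 2) (i j m i' j' m' : Fin n)
    (he : (pauliSign 0 0 i i' * pauliSign 0 l i j' * pauliSign 0 1 i m') *
      (pauliSign k 0 j i' * pauliSign k l j j' * pauliSign k 1 j m') *
      (pauliSign 1 0 m i' * pauliSign 1 l m j' * pauliSign 1 1 m m') = e) :
    CommuteUpTo e (tripleOp k i j m) (tripleOp l i' j' m') := by
  rw [← he]
  have h (p : Fin 2) (s : Fin n) :
      CommuteUpTo (pauliSign p 0 s i' * pauliSign p l s j' * pauliSign p 1 s m')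
        (onQubit (XY p) s) (tripleOp l i' j' m') :=
    ((commuteUpTo_onQubit_XY _ _ _ _).mul_right (commuteUpTo_onQubit_XY _ _ _ _)).mul_right
      (commuteUpTo_onQubit_XY _ _ _ _)
  exact ((h _ _).mul_left (h _ _)).mul_left (h _ _)

theorem onQubit_XY_mul_self {n : ℕ} (k : Fin 2) (i : Fin n) :
    onQubit (XY k) i * onQubit (XY k) i = 1 := by
  rw [onQubit_mul_onQubit, XY_mul_self, onQubit_one]

theorem commuteUpTo_one_onQubit_XY {n : ℕ} (k l : Fin 2) {i j : Fin n} (hij : i ≠ j) :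
    CommuteUpTo 1 (onQubit (XY k) i) (onQubit (XY l) j) := by
  simpa [pauliSign, hij] using commuteUpTo_onQubit_XY k l i j

theorem tripleOp_mul_self {n : ℕ} (k : Fin 2) {i j m : Fin n} (hij : i ≠ j) (him : i ≠ m)
    (hjm : j ≠ m) : tripleOp k i j m * tripleOp k i j m = 1 :=
  mul_self_mul_eq_one
    (mul_self_mul_eq_one (onQubit_XY_mul_self _ _) (onQubit_XY_mul_self _ _)
      (commuteUpTo_one_onQubit_XY _ _ hij))
    (onQubit_XY_mul_self _ _)
    ((commuteUpTo_one_onQubit_XY _ _ him).mul_left (commuteUpTo_one_onQubit_XY _ _ hjm))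

theorem tripleOp_isHermitian {n : ℕ} (k : Fin 2) {i j m : Fin n} (hij : i ≠ j) (him : i ≠ m)
    (hjm : j ≠ m) : (tripleOp k i j m).IsHermitian :=
  (((onQubit_isHermitian (XY_isHermitian _) _).mul_of_commuteUpTo_one
    (onQubit_isHermitian (XY_isHermitian _) _) (commuteUpTo_one_onQubit_XY _ _ hij))
    ).mul_of_commuteUpTo_one (onQubit_isHermitian (XY_isHermitian _) _)
    ((commuteUpTo_one_onQubit_XY _ _ him).mul_left (commuteUpTo_one_onQubit_XY _ _ hjm))

theorem tripleOp_anticommute {n : ℕ} {i j m : Fin n} (hij : i ≠ j) (him : i ≠ m)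
    (hjm : j ≠ m) : CommuteUpTo (-1) (tripleOp 0 i j m) (tripleOp 1 i j m) :=
  commuteUpTo_tripleOp _ _ _ _ _ _ _ _
    (by simp [pauliSign, hij, hjm, him, hij.symm, him.symm, hjm.symm])

/-- The normalized superposition `x σ_x σ_x σ_y + y σ_x σ_y σ_y` on the qubits `i`, `j`, `m`. -/
def tripleMix {n : ℕ} (x y : ℝ) (i j m : Fin n) : Matrix (Fin n → Fin 2) (Fin n → Fin 2) ℂ :=
  (x : ℂ) • tripleOp 0 i j m + (y : ℂ) • tripleOp 1 i j m

theorem tripleMix_mul_self {n : ℕ} {x y : ℝ} (hxy : x ^ 2 + y ^ 2 = 1) {i j m : Fin n}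
    (hij : i ≠ j) (him : i ≠ m) (hjm : j ≠ m) :
    tripleMix x y i j m * tripleMix x y i j m = 1 :=
  mul_self_smul_add_smul_eq_one (tripleOp_mul_self _ hij him hjm) (tripleOp_mul_self _ hij him hjm)
    (tripleOp_anticommute hij him hjm) hxy

theorem tripleMix_isHermitian {n : ℕ} (x y : ℝ) {i j m : Fin n} (hij : i ≠ j) (him : i ≠ m)
    (hjm : j ≠ m) : (tripleMix x y i j m).IsHermitian :=
  ((tripleOp_isHermitian _ hij him hjm).ofReal_smul x).add
    ((tripleOp_isHermitian _ hij him hjm).ofReal_smul y)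

/-- **Five-term complementarity relation used in the odd-cycle argument.** With 2h qubits
(h ≥ 5), labels 1,…,2h here 0-indexed (label ℓ corresponds to index ℓ−1), and normalized
real coefficients (α,β) and (γ,δ), the observables X₁X₂Y₃, X₁Y₂Y₃, X₃X₄Y₅, X₃Y₄Y₅ and
M₆ M_{2h} with M₆ = α X₅X₆Y₇ + β X₅Y₆Y₇ and M_{2h} = γ X_{2h−1}X_{2h}Y₁ + δ X_{2h−1}Y_{2h}Y₁
give squared expectation values summing to at most 1 in any 2h-qubit state. -/
theorem five_term_complementarity (h : ℕ) (hh : 5 ≤ h) (α β γ δ : ℝ)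
    (hab : α ^ 2 + β ^ 2 = 1) (hcd : γ ^ 2 + δ ^ 2 = 1)
    (ρ : Matrix (Fin (2 * h) → Fin 2) (Fin (2 * h) → Fin 2) ℂ) (hρ : IsDensityMatrix ρ) :
    ((ρ * (onQubit pX ⟨0, by omega⟩ * onQubit pX ⟨1, by omega⟩ *
        onQubit pY ⟨2, by omega⟩)).trace.re) ^ 2 +
    ((ρ * (onQubit pX ⟨0, by omega⟩ * onQubit pY ⟨1, by omega⟩ *
        onQubit pY ⟨2, by omega⟩)).trace.re) ^ 2 +
    ((ρ * (onQubit pX ⟨2, by omega⟩ * onQubit pX ⟨3, by omega⟩ *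
        onQubit pY ⟨4, by omega⟩)).trace.re) ^ 2 +
    ((ρ * (onQubit pX ⟨2, by omega⟩ * onQubit pY ⟨3, by omega⟩ *
        onQubit pY ⟨4, by omega⟩)).trace.re) ^ 2 +
    ((ρ * (((α : ℂ) • (onQubit pX ⟨4, by omega⟩ * onQubit pX ⟨5, by omega⟩ *
              onQubit pY ⟨6, by omega⟩) +
            (β : ℂ) • (onQubit pX ⟨4, by omega⟩ * onQubit pY ⟨5, by omega⟩ *
              onQubit pY ⟨6, by omega⟩)) *
           ((γ : ℂ) • (onQubit pX ⟨2 * h - 2, by omega⟩ * onQubit pX ⟨2 * h - 1, by omega⟩ *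
              onQubit pY ⟨0, by omega⟩) +
            (δ : ℂ) • (onQubit pX ⟨2 * h - 2, by omega⟩ * onQubit pY ⟨2 * h - 1, by omega⟩ *
              onQubit pY ⟨0, by omega⟩)))).trace.re) ^ 2
      ≤ 1 := by
  obtain ⟨hpsd, htr⟩ := hρ
  set q0 : Fin (2 * h) := ⟨0, by omega⟩ with e0
  set q1 : Fin (2 * h) := ⟨1, by omega⟩ with e1
  set q2 : Fin (2 * h) := ⟨2, by omega⟩ with e2
  set q3 : Fin (2 * h) := ⟨3, by omega⟩ with e3
  set q4 : Fin (2 * h) := ⟨4, by omega⟩ with e4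
  set q5 : Fin (2 * h) := ⟨5, by omega⟩ with e5
  set q6 : Fin (2 * h) := ⟨6, by omega⟩ with e6
  set q7 : Fin (2 * h) := ⟨2 * h - 2, by omega⟩ with e7
  set q8 : Fin (2 * h) := ⟨2 * h - 1, by omega⟩ with e8
  have hnd : [q0, q1, q2, q3, q4, q5, q6, q7, q8].Nodup := by
    simp only [List.nodup_cons, List.mem_cons, List.not_mem_nil, Fin.ext_iff, e0, e1, e2, e3, e4,
      e5, e6, e7, e8]
    simp
    omega
  clear_value q0 q1 q2 q3 q4 q5 q6 q7 q8
  clear e0 e1 e2 e3 e4 e5 e6 e7 e8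
  simp only [List.nodup_cons, List.mem_cons, List.not_mem_nil, not_or, List.nodup_nil,
    not_false_eq_true, and_true, ← ne_eq] at hnd
  obtain ⟨⟨h01, h02, h03, h04, h05, h06, h07, h08⟩, ⟨h12, h13, h14, h15, h16, h17, h18⟩,
    ⟨h23, h24, h25, h26, h27, h28⟩, ⟨h34, h35, h36, h37, h38⟩, ⟨h45, h46, h47, h48⟩,
    ⟨h56, h57, h58⟩, ⟨h67, h68⟩, h78⟩ := hnd
  have hM6 (k : Fin 2) : CommuteUpTo 1 (tripleOp k q0 q1 q2) (tripleMix α β q4 q5 q6) :=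
    (commuteUpTo_tripleOp _ _ _ _ _ _ _ _ (by simp [pauliSign, *])).smul_add_smul_right
      (commuteUpTo_tripleOp _ _ _ _ _ _ _ _ (by simp [pauliSign, *])) _ _
  have hM6' (k : Fin 2) : CommuteUpTo (-1) (tripleOp k q2 q3 q4) (tripleMix α β q4 q5 q6) :=
    (commuteUpTo_tripleOp _ _ _ _ _ _ _ _ (by simp [pauliSign, *])).smul_add_smul_right
      (commuteUpTo_tripleOp _ _ _ _ _ _ _ _ (by simp [pauliSign, *])) _ _
  have hMh (k : Fin 2) : CommuteUpTo (-1) (tripleOp k q0 q1 q2) (tripleMix γ δ q7 q8 q0) :=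
    (commuteUpTo_tripleOp _ _ _ _ _ _ _ _
      (by simp [pauliSign, *, h01.symm, h02.symm])).smul_add_smul_right
      (commuteUpTo_tripleOp _ _ _ _ _ _ _ _
        (by simp [pauliSign, *, h01.symm, h02.symm])) _ _
  have hMh' (k : Fin 2) : CommuteUpTo 1 (tripleOp k q2 q3 q4) (tripleMix γ δ q7 q8 q0) :=
    (commuteUpTo_tripleOp _ _ _ _ _ _ _ _
      (by simp [pauliSign, *, h02.symm, h03.symm, h04.symm])).smul_add_smul_right
      (commuteUpTo_tripleOp _ _ _ _ _ _ _ _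
        (by simp [pauliSign, *, h02.symm, h03.symm, h04.symm])) _ _
  have hMM' (k : Fin 2) : CommuteUpTo 1 (tripleMix γ δ q7 q8 q0) (tripleOp k q4 q5 q6) :=
    ((commuteUpTo_tripleOp _ _ _ _ _ _ _ _
      (by simp [pauliSign, *, h04.symm, h05.symm, h06.symm])).smul_add_smul_right
      (commuteUpTo_tripleOp _ _ _ _ _ _ _ _
        (by simp [pauliSign, *, h04.symm, h05.symm, h06.symm])) _ _).symm_of_mul_self (one_mul 1)
  have hMM : CommuteUpTo 1 (tripleMix α β q4 q5 q6) (tripleMix γ δ q7 q8 q0) :=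
    ((hMM' 0).smul_add_smul_right (hMM' 1) _ _).symm_of_mul_self (one_mul 1)
  have h12' (k l : Fin 2) : CommuteUpTo (-1) (tripleOp k q0 q1 q2) (tripleOp l q2 q3 q4) :=
    commuteUpTo_tripleOp _ _ _ _ _ _ _ _ (by simp [pauliSign, *])
  have hs : ∀ {a b : Matrix (Fin (2 * h) → Fin 2) (Fin (2 * h) → Fin 2) ℂ},
      CommuteUpTo (-1) a b → CommuteUpTo (-1) b a := fun hab => hab.symm_of_mul_self (by norm_num)
  have hA5 (k : Fin 2) : CommuteUpTo (-1) (tripleOp k q0 q1 q2)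
      (tripleMix α β q4 q5 q6 * tripleMix γ δ q7 q8 q0) := (hM6 k).mul_right (hMh k)
  have hA5' (k : Fin 2) : CommuteUpTo (-1) (tripleOp k q2 q3 q4)
      (tripleMix α β q4 q5 q6 * tripleMix γ δ q7 q8 q0) := (hM6' k).mul_right (hMh' k)
  have key := sum_sq_trace_re_le_one hpsd htr
    ![tripleOp 0 q0 q1 q2, tripleOp 1 q0 q1 q2, tripleOp 0 q2 q3 q4, tripleOp 1 q2 q3 q4,
      tripleMix α β q4 q5 q6 * tripleMix γ δ q7 q8 q0] ?_ ?_ ?_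
  · simpa [Fin.sum_univ_succ, tripleMix, tripleOp, XY, add_assoc] using key
  · intro i
    fin_cases i
    · exact tripleOp_isHermitian _ h01 h02 h12
    · exact tripleOp_isHermitian _ h01 h02 h12
    · exact tripleOp_isHermitian _ h23 h24 h34
    · exact tripleOp_isHermitian _ h23 h24 h34
    · exact (tripleMix_isHermitian _ _ h45 h46 h56).mul_of_commuteUpTo_one
        (tripleMix_isHermitian _ _ h78 h07.symm h08.symm) hMM
  · intro i
    fin_cases i
    · exact tripleOp_mul_self _ h01 h02 h12
    · exact tripleOp_mul_self _ h01 h02 h12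
    · exact tripleOp_mul_self _ h23 h24 h34
    · exact tripleOp_mul_self _ h23 h24 h34
    · exact mul_self_mul_eq_one (tripleMix_mul_self hab h45 h46 h56)
        (tripleMix_mul_self hcd h78 h07.symm h08.symm) hMM
  · have a01 := tripleOp_anticommute h01 h02 h12
    have a23 := tripleOp_anticommute h23 h24 h34
    simp [Fin.forall_fin_succ, a01, hs a01, a23, hs a23, h12', hs (h12' _ _), hA5, hs (hA5 _),
      hA5', hs (hA5' _)]
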